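/- Let V : ℝ → ℝ be six times continuously differentiable in a neighbourhood of 0 with V'(0) = 0 and V''(0) = 1, let Ω > 2/√3, and assume b = V⁗(0) − (5/3)(V'''(0))² > 0. Then there exist δ > 0 and ε > 0 such that there is no family (y_n)_{n∈ℤ} of even, 2π-periodic, twice continuously differentiable functions, not all identically zero, satisfying ω²(y_n)''(t) + Ω² V'(y_n(t)) = y_{n+1}(t) − 2y_n(t) + y_{n−1}(t) for all n ∈ ℤ and t ∈ ℝ with some frequency ω ∈ (Ω − δ, Ω), together with sup_n sup_t (|y_n(t)| + |y_n''(t)|) ≤ ε and sup_t(|y_n(t)| + |y_n''(t)|) → 0 as n → ±∞. -/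

import Mathlib

/-- A bounded family satisfying an affine self-improving bound. -/
theorem abs_le_of_forall_bound_improves {ι : Type*} {x : ι → ℝ} {B c θ : ℝ} (hB : ∀ i, |x i| ≤ B)
    (hθ : θ < 1)
    (h : ∀ S, 0 ≤ S → S ≤ B → (∀ i, |x i| ≤ S) → ∀ i, |x i| ≤ c + θ * S) (i : ι) :
    |x i| ≤ c / (1 - θ) := by
  have hbdd : BddAbove (Set.range fun i => |x i|) := ⟨B, by rintro _ ⟨j, rfl⟩; exact hB j⟩
  have : Nonempty ι := ⟨i⟩
  set S := ⨆ j, |x j| with hS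
  have h1 : ∀ j, |x j| ≤ S := fun j => le_ciSup hbdd j
  have h2 : S ≤ c + θ * S :=
    ciSup_le (h S ((abs_nonneg _).trans (h1 i)) (ciSup_le hB) h1)
  rw [le_div_iff₀ (by linarith)]
  nlinarith [h1 i]

theorem abs_le_of_diagonal_dominance {x : ℤ → ℝ} {B l g m : ℝ} (hB : ∀ n, |x n| ≤ B)
    (hm : 0 < m) (hl : 2 + m ≤ |l|)
    (h : ∀ n, |l * x n - x (n + 1) - x (n - 1)| ≤ g) (n : ℤ) : |x n| ≤ g / m := by
  have hl0 : 0 < |l| := by linarith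
  have hg : 0 ≤ g := (abs_nonneg _).trans (h 0)
  have key := abs_le_of_forall_bound_improves (c := g / |l|) (θ := 2 / |l|) hB
    (by rw [div_lt_one hl0]; linarith)
    (by
      intro S _ _ hS k
      have e : |l| * |x k| ≤ g + 2 * S := by
        rw [← abs_mul]
        have h1 := abs_le.1 (h k)
        have h2 := abs_le.1 (hS (k + 1))
        have h3 := abs_le.1 (hS (k - 1))
        exact abs_le.2 ⟨by linarith, by linarith⟩
      rw [div_add' _ _ _ hl0.ne', div_mul_eq_mul_div, div_mul_cancel₀ _ hl0.ne', le_div_iff₀ hl0]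
      linarith) n
  refine key.trans ?_
  have : g / |l| / (1 - 2 / |l|) = g / (|l| - 2) := by
    field_simp
  rw [this]
  exact div_le_div_of_nonneg_left hg hm (by linarith)

theorem abs_sub_le_of_abs_second_difference_le {a : ℤ → ℝ} {A c : ℝ} (hA : ∀ n, |a n| ≤ A)
    (hc : ∀ n, |a (n + 1) - 2 * a n + a (n - 1)| ≤ c) {m : ℕ} (hm : 0 < m) (n : ℤ) :
    |a (n + 1) - a n| ≤ 2 * A / m + m * c := by
  have hc0 : 0 ≤ c := (abs_nonneg _).trans (hc 0)
  have h1 : ∀ j : ℕ, |(a (n + j + 1) - a (n + j)) - (a (n + 1) - a n)| ≤ j * c := by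
    intro j
    induction j with
    | zero => simp
    | succ j ih =>
      have := hc (n + j + 1)
      have e : n + (j : ℤ) + 1 - 1 = n + j := by ring
      rw [e] at this
      push_cast
      rw [← add_assoc]
      have h2 := abs_le.1 this
      have h3 := abs_le.1 ih
      exact abs_le.2 ⟨by linarith, by linarith⟩
  have h2 : ∀ j : ℕ, j ≤ m → |(a (n + j) - a n) - j * (a (n + 1) - a n)| ≤ j * (m * c) := by
    intro j
    induction j with
    | zero => simp
    | succ j ih =>
      intro hj
      have h3 := abs_le.1 (ih (by omega))
      have h4 := abs_le.1 (h1 j)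
      have : (j : ℝ) * c ≤ m * c :=
        mul_le_mul_of_nonneg_right (by exact_mod_cast (by omega : j ≤ m)) hc0
      push_cast
      rw [← add_assoc]
      exact abs_le.2 ⟨by linarith, by linarith⟩
  have h3 := abs_le.1 (h2 m le_rfl)
  have h4 := abs_le.1 (hA (n + m))
  have h5 := abs_le.1 (hA n)
  have hm' : (0 : ℝ) < m := by exact_mod_cast hm
  have h6 : m * |a (n + 1) - a n| ≤ 2 * A + m * (m * c) := by
    rw [← abs_of_pos hm', ← abs_mul, abs_of_pos hm']
    exact abs_le.2 ⟨by linarith, by linarith⟩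
  rw [div_add' _ _ _ hm'.ne', le_div_iff₀ hm']
  linarith

/-- If the cosine coefficients of an even periodic function decay quadratically, the function
is bounded by a universal constant times the bound of the coefficients. -/
theorem exists_abs_le_of_cos_coeff_bound : ∃ C > (0 : ℝ), ∀ (f : ℝ → ℝ) (M : ℝ), Continuous f →
    Function.Periodic f (2 * Real.pi) → (∀ t, f (-t) = f t) →
    |∫ t in (0 : ℝ)..2 * Real.pi, f t| ≤ M →
    (∀ k : ℕ, 0 < k → |∫ t in (0 : ℝ)..2 * Real.pi, f t * Real.cos (k * t)| ≤ M / k ^ 2) →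
    ∀ t, |f t| ≤ C * M := by
  have hsum : Summable fun i : ℤ => 1 / (i : ℝ) ^ 2 :=
    Real.summable_one_div_int_pow.2 one_lt_two
  let w : ℤ → ℝ := fun i => (if i = 0 then 1 else 0) + 1 / (i : ℝ) ^ 2
  have hw0 : ∀ i, 0 ≤ w i := fun i => by dsimp [w]; split_ifs <;> positivity
  have hw : Summable w := (summable_of_ne_finset_zero (s := {0}) (by simp)).add hsum
  have hwpos : 0 < ∑' i, w i := hw.tsum_pos hw0 0 (by simp [w])
  refine ⟨∑' i, w i, hwpos, ?_⟩
  intro f M hf hper heven h0 hk t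
  have hM : 0 ≤ M := (abs_nonneg _).trans h0
  have : Fact (0 < 2 * Real.pi) := ⟨Real.two_pi_pos⟩
  have hperC : Function.Periodic (fun t => (f t : ℂ)) (2 * Real.pi) := fun t => by
    simp only [hper t]
  let F : C(AddCircle (2 * Real.pi), ℂ) :=
    ⟨hperC.lift, continuous_coinduced_dom.mpr (Complex.continuous_ofReal.comp hf)⟩
  have hFt : ∀ t : ℝ, F (t : AddCircle (2 * Real.pi)) = f t := fun t => rfl
  have hsin : ∀ i : ℤ, ∫ t in (0 : ℝ)..2 * Real.pi, f t * Real.sin (i * t) = 0 := by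
    intro i
    have h := intervalIntegral.integral_comp_sub_left (a := 0) (b := 2 * Real.pi)
      (fun t => f t * Real.sin (i * t)) (2 * Real.pi)
    simp only [sub_self, sub_zero] at h
    have e : ∀ t : ℝ, f (2 * Real.pi - t) * Real.sin (i * (2 * Real.pi - t))
        = -(f t * Real.sin (i * t)) := by
      intro t
      rw [show 2 * Real.pi - t = -t + 2 * Real.pi by ring, hper, heven,
        show (i : ℝ) * (-t + 2 * Real.pi) = -(i * t) + i * (2 * Real.pi) by ring,
        Real.sin_add_int_mul_two_pi, Real.sin_neg]
      ring
    simp only [e, intervalIntegral.integral_neg] at h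
    linarith
  have hcoeff : ∀ i : ℤ, ‖fourierCoeff F i‖ ≤ w i * M := by
    intro i
    have h1 : fourierCoeff F i = ((1 / (2 * Real.pi) *
        ∫ t in (0 : ℝ)..2 * Real.pi, f t * Real.cos (i * t) : ℝ) : ℂ) := by
      rw [fourierCoeff_eq_intervalIntegral _ _ 0, zero_add]
      have e : ∀ t : ℝ, fourier (-i) (t : AddCircle (2 * Real.pi)) • F t
          = ((f t * Real.cos (i * t) : ℝ) : ℂ) - ((f t * Real.sin (i * t) : ℝ) : ℂ) * Complex.I := by
        intro t
        rw [hFt, fourier_coe_apply, smul_eq_mul]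
        have : 2 * (Real.pi : ℂ) * Complex.I * ((-i : ℤ) : ℂ) * t / ((2 * Real.pi : ℝ) : ℂ)
            = (-(i * t : ℝ) : ℂ) * Complex.I := by
          push_cast
          field_simp
        rw [this, Complex.exp_mul_I]
        push_cast
        rw [Complex.cos_neg, Complex.sin_neg]
        ring
      simp only [e]
      rw [intervalIntegral.integral_sub
        (Continuous.intervalIntegrable (by fun_prop) _ _)
        (Continuous.intervalIntegrable (by fun_prop) _ _),
        intervalIntegral.integral_mul_const, intervalIntegral.integral_ofReal,
        intervalIntegral.integral_ofReal, hsin]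
      simp
    rw [h1, Complex.norm_real, Real.norm_eq_abs, abs_mul]
    have hpi : |1 / (2 * Real.pi)| ≤ 1 := by
      rw [abs_of_pos (by positivity), div_le_one (by positivity)]
      linarith [Real.pi_gt_three]
    refine (mul_le_of_le_one_left (abs_nonneg _) hpi).trans ?_
    rcases eq_or_ne i 0 with rfl | hi
    · simpa [w] using h0
    · have h2 := hk i.natAbs (Int.natAbs_pos.2 hi)
      have hc : ∀ t : ℝ, Real.cos ((i.natAbs : ℝ) * t) = Real.cos (i * t) := by
        intro t
        rw [Nat.cast_natAbs, Int.cast_abs]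
        rcases abs_choice (i : ℝ) with h | h <;> rw [h]
        rw [neg_mul, Real.cos_neg]
      simp only [hc] at h2
      refine h2.trans (le_of_eq ?_)
      simp [w, hi]
      ring
  have hs : Summable (fourierCoeff F) := Summable.of_norm_bounded (hw.mul_right M) hcoeff
  have hpt := has_pointwise_sum_fourier_series_of_summable hs (t : AddCircle (2 * Real.pi))
  have h3 := tsum_of_norm_bounded (hw.mul_right M).hasSum (f := fun i => fourierCoeff F i •
    fourier i (t : AddCircle (2 * Real.pi))) (fun i => by
      rw [norm_smul, fourier_apply, Circle.norm_coe, mul_one]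
      exact hcoeff i)
  rw [hpt.tsum_eq, hFt, Complex.norm_real, tsum_mul_right] at h3
  exact h3

/-- Even `2π`-periodic functions of class `C²`. -/
structure IsEvenPeriodicC2 (f : ℝ → ℝ) : Prop where
  contDiff : ContDiff ℝ 2 f
  periodic : Function.Periodic f (2 * Real.pi)
  even : ∀ t, f (-t) = f t

theorem isEvenPeriodicC2_cos : IsEvenPeriodicC2 Real.cos :=
  ⟨Real.contDiff_cos, Real.cos_periodic, Real.cos_neg⟩

namespace IsEvenPeriodicC2

variable {f g : ℝ → ℝ}

theorem continuous (hf : IsEvenPeriodicC2 f) : Continuous f := hf.contDiff.continuous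

theorem contDiff_deriv (hf : IsEvenPeriodicC2 f) : ContDiff ℝ 1 (deriv f) :=
  ((contDiff_succ_iff_deriv (n := 1)).1 hf.contDiff).2.2

theorem hasDerivAt (hf : IsEvenPeriodicC2 f) (t : ℝ) : HasDerivAt f (deriv f t) t :=
  (hf.contDiff.differentiable (by norm_num) t).hasDerivAt

theorem hasDerivAt_deriv (hf : IsEvenPeriodicC2 f) (t : ℝ) :
    HasDerivAt (deriv f) (deriv (deriv f) t) t :=
  (hf.contDiff_deriv.differentiable (by norm_num) t).hasDerivAt

theorem continuous_deriv_deriv (hf : IsEvenPeriodicC2 f) : Continuous (deriv (deriv f)) :=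
  hf.contDiff_deriv.continuous_deriv le_rfl

theorem sub (hf : IsEvenPeriodicC2 f) (hg : IsEvenPeriodicC2 g) :
    IsEvenPeriodicC2 (fun t => f t - g t) :=
  ⟨hf.contDiff.sub hg.contDiff, fun t => by simp only [hf.periodic t, hg.periodic t],
    fun t => by simp only [hf.even t, hg.even t]⟩

theorem const_mul (hf : IsEvenPeriodicC2 f) (c : ℝ) : IsEvenPeriodicC2 (fun t => c * f t) :=
  ⟨contDiff_const.mul hf.contDiff, fun t => by simp only [hf.periodic t],
    fun t => by simp only [hf.even t]⟩

theorem deriv_deriv_sub (hf : IsEvenPeriodicC2 f) (hg : IsEvenPeriodicC2 g) (t : ℝ) :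
    deriv (deriv fun t => f t - g t) t = deriv (deriv f) t - deriv (deriv g) t := by
  have h : (deriv fun t => f t - g t) = fun t => deriv f t - deriv g t :=
    funext fun t => ((hf.hasDerivAt t).sub (hg.hasDerivAt t)).deriv
  rw [h]
  exact ((hf.hasDerivAt_deriv t).sub (hg.hasDerivAt_deriv t)).deriv

theorem deriv_deriv_const_mul (hf : IsEvenPeriodicC2 f) (c t : ℝ) :
    deriv (deriv fun t => c * f t) t = c * deriv (deriv f) t := by
  have h : (deriv fun t => c * f t) = fun t => c * deriv f t :=
    funext fun t => ((hf.hasDerivAt t).const_mul c).deriv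
  rw [h]
  exact ((hf.hasDerivAt_deriv t).const_mul c).deriv

theorem integral_deriv_deriv_mul_cos (hf : IsEvenPeriodicC2 f) (k : ℕ) :
    ∫ t in (0 : ℝ)..2 * Real.pi, deriv (deriv f) t * Real.cos (k * t) =
      -(k : ℝ) ^ 2 * ∫ t in (0 : ℝ)..2 * Real.pi, f t * Real.cos (k * t) := by
  have hP : ∀ t, HasDerivAt (fun t => deriv f t * Real.cos (k * t) + k * (f t * Real.sin (k * t)))
      (deriv (deriv f) t * Real.cos (k * t) + (k : ℝ) ^ 2 * (f t * Real.cos (k * t))) t := by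
    intro t
    have hk : HasDerivAt (fun t : ℝ => (k : ℝ) * t) k t := by
      simpa using (hasDerivAt_id t).const_mul (k : ℝ)
    convert! ((hf.hasDerivAt_deriv t).mul hk.cos).add
      (((hf.hasDerivAt t).mul hk.sin).const_mul (k : ℝ)) using 1
    ring
  have hc := hf.continuous
  have hc2 := hf.continuous_deriv_deriv
  have h := intervalIntegral.integral_eq_sub_of_hasDerivAt (a := 0) (b := 2 * Real.pi)
    (fun t _ => hP t) (Continuous.intervalIntegrable (by fun_prop) _ _)
  rw [intervalIntegral.integral_add (Continuous.intervalIntegrable (by fun_prop) _ _)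
    (Continuous.intervalIntegrable (by fun_prop) _ _), intervalIntegral.integral_const_mul] at h
  have hd : deriv f (2 * Real.pi) = deriv f 0 := by
    have : (fun t => f (t + 2 * Real.pi)) = f := funext hf.periodic
    have h2 := deriv_comp_add_const f (2 * Real.pi) 0
    rw [this, zero_add] at h2
    exact h2.symm
  have hs : Real.sin (k * (2 * Real.pi)) = 0 := by
    simpa using Real.sin_add_nat_mul_two_pi 0 k
  rw [Real.cos_nat_mul_two_pi, hs, hd] at h
  simp at h
  linarith

end IsEvenPeriodicC2

theorem integral_cos_mul_cos_nat {k : ℕ} (hk : k ≠ 1) :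
    ∫ t in (0 : ℝ)..2 * Real.pi, Real.cos t * Real.cos (k * t) = 0 := by
  have h := isEvenPeriodicC2_cos.integral_deriv_deriv_mul_cos k
  have e : ∀ t, deriv (deriv Real.cos) t = -Real.cos t := by
    intro t
    simp
  simp only [e, neg_mul, intervalIntegral.integral_neg] at h
  have h2 : ((k : ℝ) ^ 2 - 1) * ∫ t in (0 : ℝ)..2 * Real.pi, Real.cos t * Real.cos (k * t) = 0 := by
    linarith
  refine (mul_eq_zero.1 h2).resolve_left fun h3 => hk ?_
  have h4 : (k : ℝ) ^ 2 = 1 := by linarith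
  exact (Nat.pow_eq_one.1 (by exact_mod_cast h4)).resolve_right two_ne_zero

theorem abs_integral_mul_cos_le {g : ℝ → ℝ} {G : ℝ} (hG : ∀ t, |g t| ≤ G) (k : ℝ) :
    |∫ t in (0 : ℝ)..2 * Real.pi, g t * Real.cos (k * t)| ≤ 2 * Real.pi * G := by
  have h := intervalIntegral.norm_integral_le_of_norm_le_const (a := 0) (b := 2 * Real.pi)
    (f := fun t => g t * Real.cos (k * t)) (C := G) (fun t _ => by
      rw [Real.norm_eq_abs, abs_mul]
      exact (mul_le_of_le_one_right (abs_nonneg _) (Real.abs_cos_le_one _)).trans (hG t))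
  rw [sub_zero, abs_of_pos Real.two_pi_pos, Real.norm_eq_abs] at h
  linarith

/-- The linearised lattice equation controls functions without first harmonic in the sup norm,
uniformly in a forcing along `cos`. -/
def NonresonantEstimate (Ω ω K : ℝ) : Prop :=
  ∀ (z g : ℤ → ℝ → ℝ) (h : ℤ → ℝ) (B G : ℝ), (∀ n, IsEvenPeriodicC2 (z n)) →
    (∀ n, ∫ t in (0 : ℝ)..2 * Real.pi, z n t * Real.cos t = 0) →
    (∀ n t, |z n t| ≤ B) → (∀ n t, |g n t| ≤ G) →
    (∀ n t, ω ^ 2 * deriv (deriv (z n)) t + Ω ^ 2 * z n t + g n t =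
      z (n + 1) t - 2 * z n t + z (n - 1) t + h n * Real.cos t) →
    ∀ n t, |z n t| ≤ K * G

theorem exists_nonresonantEstimate {Ω m : ℝ} (hΩ : 0 < Ω) (hm : 0 < m) :
    ∃ K > (0 : ℝ), ∀ ω : ℝ, m ≤ 4 * ω ^ 2 - Ω ^ 2 - 4 → NonresonantEstimate Ω ω K := by
  obtain ⟨C, hC, hF⟩ := exists_abs_le_of_cos_coeff_bound
  refine ⟨C * (2 * Real.pi * (1 / Ω ^ 2 + 4 / m)), by positivity, ?_⟩
  intro ω hω z g h B G hz hz1 hB hG heq n t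
  have hG0 : 0 ≤ G := (abs_nonneg _).trans (hG 0 0)
  have hmode : ∀ k : ℕ, k ≠ 1 → ∀ n,
      (2 + Ω ^ 2 - ω ^ 2 * k ^ 2) * (∫ t in (0 : ℝ)..2 * Real.pi, z n t * Real.cos (k * t))
        - (∫ t in (0 : ℝ)..2 * Real.pi, z (n + 1) t * Real.cos (k * t))
        - (∫ t in (0 : ℝ)..2 * Real.pi, z (n - 1) t * Real.cos (k * t))
      = -∫ t in (0 : ℝ)..2 * Real.pi, g n t * Real.cos (k * t) := by
    intro k hk n
    have hc0 := (hz n).continuous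
    have hc1 := (hz (n + 1)).continuous
    have hc2 := (hz (n - 1)).continuous
    have hc3 := (hz n).continuous_deriv_deriv
    have e : ∀ t, g n t * Real.cos (k * t) =
        z (n + 1) t * Real.cos (k * t) + z (n - 1) t * Real.cos (k * t)
          - (2 + Ω ^ 2) * (z n t * Real.cos (k * t))
          - ω ^ 2 * (deriv (deriv (z n)) t * Real.cos (k * t))
          + h n * (Real.cos t * Real.cos (k * t)) := by
      intro t
      have : g n t = z (n + 1) t - 2 * z n t + z (n - 1) t + h n * Real.cos t
        - ω ^ 2 * deriv (deriv (z n)) t - Ω ^ 2 * z n t := by linarith [heq n t]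
      rw [this]
      ring
    simp only [e]
    have I : ∀ {φ : ℝ → ℝ}, Continuous φ →
        IntervalIntegrable φ MeasureTheory.volume 0 (2 * Real.pi) :=
      fun hφ => hφ.intervalIntegrable _ _
    rw [intervalIntegral.integral_add (I (by fun_prop)) (I (by fun_prop)),
      intervalIntegral.integral_sub (I (by fun_prop)) (I (by fun_prop)),
      intervalIntegral.integral_sub (I (by fun_prop)) (I (by fun_prop)),
      intervalIntegral.integral_add (I (by fun_prop)) (I (by fun_prop)),
      intervalIntegral.integral_const_mul, intervalIntegral.integral_const_mul,
      intervalIntegral.integral_const_mul, (hz n).integral_deriv_deriv_mul_cos,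
      integral_cos_mul_cos_nat hk]
    ring
  have hmodeg : ∀ k : ℕ, k ≠ 1 → ∀ n,
      |(2 + Ω ^ 2 - ω ^ 2 * k ^ 2) * (∫ t in (0 : ℝ)..2 * Real.pi, z n t * Real.cos (k * t))
        - (∫ t in (0 : ℝ)..2 * Real.pi, z (n + 1) t * Real.cos (k * t))
        - (∫ t in (0 : ℝ)..2 * Real.pi, z (n - 1) t * Real.cos (k * t))|
      ≤ 2 * Real.pi * G := fun k hk n => by
    rw [hmode k hk n, abs_neg]
    exact abs_integral_mul_cos_le (hG n) k
  rw [mul_assoc]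
  refine hF (z n) _ (hz n).continuous (hz n).periodic (hz n).even ?_ ?_ t
  · have h0 := abs_le_of_diagonal_dominance (m := Ω ^ 2)
      (fun n => abs_integral_mul_cos_le (hB n) (0 : ℕ)) (by positivity)
      (by simp only [Nat.cast_zero]; rw [abs_of_pos] <;> nlinarith) (hmodeg 0 (by norm_num)) n
    simp only [Nat.cast_zero, zero_mul, Real.cos_zero, mul_one] at h0
    refine h0.trans ?_
    have : 0 ≤ 2 * Real.pi * G * (4 / m) := by positivity
    have e : 2 * Real.pi * G / Ω ^ 2 = 2 * Real.pi * G * (1 / Ω ^ 2) := by ring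
    rw [e]
    linarith
  · intro k hk
    have hk2 : (0 : ℝ) < (k : ℝ) ^ 2 := by positivity
    rcases eq_or_ne k 1 with rfl | hk1
    · simp only [Nat.cast_one, one_mul, hz1, abs_zero]
      positivity
    have hk4 : (4 : ℝ) ≤ (k : ℝ) ^ 2 := by
      have : (2 : ℝ) ≤ k := by exact_mod_cast (by omega : 2 ≤ k)
      nlinarith
    have h0 := abs_le_of_diagonal_dominance (m := k ^ 2 * m / 4)
      (fun n => abs_integral_mul_cos_le (hB n) k) (by positivity)
      (by
        have h1 : (k : ℝ) ^ 2 * m ≤ (k : ℝ) ^ 2 * (4 * ω ^ 2 - Ω ^ 2 - 4) :=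
          mul_le_mul_of_nonneg_left hω hk2.le
        have h2 : 4 * (Ω ^ 2 + 4) ≤ (k : ℝ) ^ 2 * (Ω ^ 2 + 4) :=
          mul_le_mul_of_nonneg_right hk4 (by positivity)
        refine le_trans ?_ (neg_le_abs _)
        linarith) (hmodeg k hk1) n
    refine h0.trans ?_
    have e : 2 * Real.pi * G / (k ^ 2 * m / 4) = 2 * Real.pi * G * (4 / m) / k ^ 2 := by
      field_simp
    rw [e]
    refine div_le_div_of_nonneg_right ?_ hk2.le
    have : 0 ≤ 2 * Real.pi * G * (1 / Ω ^ 2) := by positivity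
    linarith

/-- Third-order Taylor expansion of `V'` at a nondegenerate critical point. -/
theorem deriv_taylor_three {V : ℝ → ℝ} {r : ℝ} (hr : 0 < r)
    (hV : ContDiffOn ℝ 6 V (Metric.ball 0 r)) (hV1 : deriv V 0 = 0)
    (hV2 : iteratedDeriv 2 V 0 = 1) {τ : ℝ} (hτ : 0 < τ) :
    ∃ ρ > (0 : ℝ), ∀ x, |x| ≤ ρ →
      |deriv V x - x - iteratedDeriv 3 V 0 / 2 * x ^ 2 - iteratedDeriv 4 V 0 / 6 * x ^ 3|
        ≤ τ * |x| ^ 3 := by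
  have hopen : IsOpen (Metric.ball (0 : ℝ) r) := Metric.isOpen_ball
  have h0 : (0 : ℝ) ∈ Metric.ball (0 : ℝ) r := Metric.mem_ball_self hr
  have hW : ContDiffOn ℝ (3 : ℕ) (deriv V) (Metric.ball 0 r) :=
    hV.deriv_of_isOpen hopen (by norm_num)
  have ht := taylor_isLittleO (convex_ball 0 r) h0 hW
  rw [hopen.nhdsWithin_eq h0] at ht
  have hpoly : ∀ x, taylorWithinEval (deriv V) 3 (Metric.ball 0 r) 0 x
      = x + iteratedDeriv 3 V 0 / 2 * x ^ 2 + iteratedDeriv 4 V 0 / 6 * x ^ 3 := by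
    intro x
    have hd : ∀ k, iteratedDerivWithin k (deriv V) (Metric.ball 0 r) 0 =
        iteratedDeriv (k + 1) V 0 := by
      intro k
      rw [iteratedDerivWithin_of_isOpen hopen h0, iteratedDeriv_succ']
    simp only [taylor_within_apply, hd, Finset.sum_range_succ, Finset.sum_range_zero]
    norm_num [hV2, iteratedDeriv_one, hV1, Nat.factorial]
    ring
  have h1 := ht.bound hτ
  obtain ⟨ρ, hρ, hball⟩ := Metric.eventually_nhds_iff.1 h1
  refine ⟨ρ / 2, by positivity, fun x hx => ?_⟩
  have h2 := hball (y := x) (by rw [Real.dist_eq, sub_zero]; linarith)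
  rw [hpoly, sub_zero, Real.norm_eq_abs, Real.norm_eq_abs, abs_pow] at h2
  convert h2 using 2
  ring

theorem integral_mul_cos_eq {y : ℤ → ℝ → ℝ} {φ : ℝ → ℝ} {ω Ω : ℝ}
    (hΩ : 0 < Ω) (hy : ∀ n, IsEvenPeriodicC2 (y n)) {n : ℤ}
    (heq : ∀ t, ω ^ 2 * deriv (deriv (y n)) t + Ω ^ 2 * y n t + Ω ^ 2 * φ (y n t) =
      y (n + 1) t - 2 * y n t + y (n - 1) t) :
    Continuous (fun t => φ (y n t)) ∧
    (∫ t in (0 : ℝ)..2 * Real.pi, y (n + 1) t * Real.cos t)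
      - 2 * (∫ t in (0 : ℝ)..2 * Real.pi, y n t * Real.cos t)
      + (∫ t in (0 : ℝ)..2 * Real.pi, y (n - 1) t * Real.cos t)
    = (Ω ^ 2 - ω ^ 2) * (∫ t in (0 : ℝ)..2 * Real.pi, y n t * Real.cos t)
      + Ω ^ 2 * ∫ t in (0 : ℝ)..2 * Real.pi, φ (y n t) * Real.cos t := by
  have hc0 := (hy n).continuous
  have hc1 := (hy (n + 1)).continuous
  have hc2 := (hy (n - 1)).continuous
  have hc3 := (hy n).continuous_deriv_deriv
  have hφ : (fun t => φ (y n t)) = fun t => 1 / Ω ^ 2 * (y (n + 1) t - 2 * y n t + y (n - 1) t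
      - ω ^ 2 * deriv (deriv (y n)) t - Ω ^ 2 * y n t) := by
    funext t
    rw [← heq t]
    field_simp
    ring
  have hcφ : Continuous (fun t => φ (y n t)) := by
    rw [hφ]
    fun_prop
  refine ⟨hcφ, ?_⟩
  have I : ∀ {φ : ℝ → ℝ}, Continuous φ →
      IntervalIntegrable φ MeasureTheory.volume 0 (2 * Real.pi) :=
    fun hφ => hφ.intervalIntegrable _ _
  have e : ∀ t, Ω ^ 2 * (φ (y n t) * Real.cos t) = y (n + 1) t * Real.cos t
      + y (n - 1) t * Real.cos t - (2 + Ω ^ 2) * (y n t * Real.cos t)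
      - ω ^ 2 * (deriv (deriv (y n)) t * Real.cos t) := by
    intro t
    linear_combination Real.cos t * heq t
  have h1 := (hy n).integral_deriv_deriv_mul_cos 1
  simp only [Nat.cast_one, one_mul] at h1
  rw [← intervalIntegral.integral_const_mul (Ω ^ 2)]
  simp only [e]
  rw [intervalIntegral.integral_sub (I (by fun_prop)) (I (by fun_prop)),
    intervalIntegral.integral_sub (I (by fun_prop)) (I (by fun_prop)),
    intervalIntegral.integral_add (I (by fun_prop)) (I (by fun_prop)),
    intervalIntegral.integral_const_mul, intervalIntegral.integral_const_mul, h1]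
  ring

theorem integral_cos_sq_two_pi : ∫ t in (0 : ℝ)..2 * Real.pi, Real.cos t ^ 2 = Real.pi := by
  rw [integral_cos_sq]
  simp

theorem integral_cos_pow_three_two_pi : ∫ t in (0 : ℝ)..2 * Real.pi, Real.cos t ^ 3 = 0 := by
  rw [integral_cos_pow_three]
  simp

theorem integral_cos_pow_four_two_pi :
    ∫ t in (0 : ℝ)..2 * Real.pi, Real.cos t ^ 4 = 3 / 4 * Real.pi := by
  rw [integral_cos_pow (n := 2), integral_cos_sq_two_pi]
  norm_num

theorem exists_forall_abs_le_of_decay {x : ℤ → ℝ}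
    (h : ∀ η > (0 : ℝ), ∃ N : ℕ, ∀ n : ℤ, N ≤ n.natAbs → |x n| ≤ η) :
    ∃ n₀, ∀ n, |x n| ≤ |x n₀| := by
  by_cases h0 : ∀ n, x n = 0
  · exact ⟨0, fun n => by rw [h0 n, h0 0]⟩
  push Not at h0
  obtain ⟨k, hk⟩ := h0
  obtain ⟨N, hN⟩ := h |x k| (abs_pos.2 hk)
  obtain ⟨n₀, -, hn₀⟩ := Finset.exists_max_image (insert k (Finset.Icc (-(N : ℤ)) N))
    (fun n => |x n|) ⟨k, Finset.mem_insert_self _ _⟩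
  refine ⟨n₀, fun n => ?_⟩
  by_cases hn : N ≤ n.natAbs
  · exact (hN n hn).trans (hn₀ k (Finset.mem_insert_self _ _))
  · exact hn₀ n (Finset.mem_insert_of_mem (Finset.mem_Icc.2 (by omega)))

section Cubic

variable {φ α β τ x : ℝ}

theorem abs_le_of_cubic_expansion (h : |φ - α / 2 * x ^ 2 - β / 6 * x ^ 3| ≤ τ * |x| ^ 3)
    {S : ℝ} (hτ : 0 ≤ τ) (hx : |x| ≤ S) (hS : S ≤ 1) :
    |φ| ≤ (|α| / 2 + (|β| / 6 + τ)) * S ^ 2 := by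
  have hS0 : 0 ≤ S := (abs_nonneg _).trans hx
  have e : φ = (φ - α / 2 * x ^ 2 - β / 6 * x ^ 3) + α / 2 * x ^ 2 + β / 6 * x ^ 3 := by ring
  have h2 : |x| ^ 2 ≤ S ^ 2 := by gcongr
  have h3 : |x| ^ 3 ≤ S ^ 2 := by
    calc |x| ^ 3 ≤ S ^ 3 := by gcongr
      _ ≤ S ^ 2 := pow_le_pow_of_le_one hS0 hS (by norm_num)
  calc |φ| ≤ |φ - α / 2 * x ^ 2 - β / 6 * x ^ 3| + |α / 2 * x ^ 2| + |β / 6 * x ^ 3| := by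
        conv_lhs => rw [e]
        exact abs_add_three _ _ _
    _ ≤ τ * |x| ^ 3 + |α| / 2 * |x| ^ 2 + |β| / 6 * |x| ^ 3 := by
        rw [abs_mul, abs_mul, abs_div, abs_div, abs_pow, abs_pow]
        norm_num
        exact h
    _ ≤ τ * S ^ 2 + |α| / 2 * S ^ 2 + |β| / 6 * S ^ 2 := by gcongr
    _ = _ := by ring

theorem abs_sub_quadratic_le_of_cubic_expansion {u z A D : ℝ}
    (h : |φ - α / 2 * x ^ 2 - β / 6 * x ^ 3| ≤ τ * |x| ^ 3) (hτ : 0 ≤ τ)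
    (hxu : x = u + z) (hx : |x| ≤ 2 * A) (hu : |u| ≤ A) (hz : |z| ≤ D * A ^ 2) :
    |φ - α / 2 * u ^ 2| ≤ (8 * (|β| / 6 + τ) + 3 / 2 * |α| * D) * A ^ 3 := by
  have hA : 0 ≤ A := (abs_nonneg _).trans hu
  have e : φ - α / 2 * u ^ 2
      = (φ - α / 2 * x ^ 2 - β / 6 * x ^ 3) + α / 2 * (z * (x + u)) + β / 6 * x ^ 3 := by
    rw [hxu]; ring
  have h3 : |x| ^ 3 ≤ (2 * A) ^ 3 := by gcongr
  have hxu' : |x + u| ≤ 3 * A := (abs_add_le _ _).trans (by linarith)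
  have hprod : |z| * |x + u| ≤ D * A ^ 2 * (3 * A) :=
    mul_le_mul hz hxu' (abs_nonneg _) ((abs_nonneg _).trans hz)
  calc |φ - α / 2 * u ^ 2|
      ≤ |φ - α / 2 * x ^ 2 - β / 6 * x ^ 3| + |α / 2 * (z * (x + u))| + |β / 6 * x ^ 3| := by
        rw [e]
        exact abs_add_three _ _ _
    _ ≤ τ * |x| ^ 3 + |α| / 2 * (|z| * |x + u|) + |β| / 6 * |x| ^ 3 := by
        rw [abs_mul, abs_mul (β / 6), abs_div, abs_div, abs_pow, abs_mul z]
        norm_num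
        exact h
    _ ≤ τ * (2 * A) ^ 3 + |α| / 2 * (D * A ^ 2 * (3 * A)) + |β| / 6 * (2 * A) ^ 3 := by gcongr
    _ = _ := by ring

theorem abs_sub_cubic_le_of_cubic_expansion {u z ζ r A D E q : ℝ}
    (h : |φ - α / 2 * x ^ 2 - β / 6 * x ^ 3| ≤ τ * |x| ^ 3) (hτ : 0 ≤ τ)
    (hxu : x = u + z) (hzr : z = ζ + r) (hx : |x| ≤ 2 * A) (hu : |u| ≤ A) (hD : 0 ≤ D)
    (hz : |z| ≤ D * A ^ 2) (hr : |r| ≤ E * q * A ^ 2) (hAq : A ≤ q) :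
    |φ - (α / 2 * u ^ 2 + α * u * ζ + β / 6 * u ^ 3)|
      ≤ (8 * τ + (|α| / 2 * (2 * E + D ^ 2) + 7 / 6 * |β| * D) * q) * A ^ 3 := by
  have hA : 0 ≤ A := (abs_nonneg _).trans hu
  have e : φ - (α / 2 * u ^ 2 + α * u * ζ + β / 6 * u ^ 3)
      = (φ - α / 2 * x ^ 2 - β / 6 * x ^ 3) + α / 2 * (2 * u * r + z ^ 2)
        + β / 6 * (z * (x ^ 2 + x * u + u ^ 2)) := by
    have : r = z - ζ := by rw [hzr]; ring
    rw [hxu, this]; ring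
  have h3 : |x| ^ 3 ≤ (2 * A) ^ 3 := by gcongr
  have h4 : |2 * u * r + z ^ 2| ≤ (2 * E + D ^ 2) * q * A ^ 3 := by
    have h5 : |u| * |r| ≤ A * (E * q * A ^ 2) := mul_le_mul hu hr (abs_nonneg _) hA
    have h6 : |z| ^ 2 ≤ (D * A ^ 2) ^ 2 := by gcongr
    have h7 : D ^ 2 * A ^ 3 * A ≤ D ^ 2 * A ^ 3 * q := by gcongr
    calc |2 * u * r + z ^ 2| ≤ |2 * u * r| + |z ^ 2| := abs_add_le _ _
      _ = 2 * (|u| * |r|) + |z| ^ 2 := by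
          rw [abs_mul, abs_mul, abs_pow]; norm_num; ring
      _ ≤ _ := by linarith
  have h8 : |z * (x ^ 2 + x * u + u ^ 2)| ≤ 7 * D * q * A ^ 3 := by
    have h9 : |x ^ 2 + x * u + u ^ 2| ≤ 7 * A ^ 2 := by
      calc |x ^ 2 + x * u + u ^ 2| ≤ |x ^ 2| + |x * u| + |u ^ 2| := abs_add_three _ _ _
        _ = |x| ^ 2 + |x| * |u| + |u| ^ 2 := by rw [abs_pow, abs_pow, abs_mul]
        _ ≤ (2 * A) ^ 2 + (2 * A) * A + A ^ 2 := by gcongr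
        _ = _ := by ring
    have h7 : D * A ^ 3 * A ≤ D * A ^ 3 * q := by gcongr
    rw [abs_mul]
    have := mul_le_mul hz h9 (abs_nonneg _) (by positivity)
    linarith
  calc |φ - (α / 2 * u ^ 2 + α * u * ζ + β / 6 * u ^ 3)|
      ≤ |φ - α / 2 * x ^ 2 - β / 6 * x ^ 3| + |α / 2 * (2 * u * r + z ^ 2)|
        + |β / 6 * (z * (x ^ 2 + x * u + u ^ 2))| := by
        rw [e]
        exact abs_add_three _ _ _
    _ ≤ τ * |x| ^ 3 + |α| / 2 * |2 * u * r + z ^ 2|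
        + |β| / 6 * |z * (x ^ 2 + x * u + u ^ 2)| := by
        rw [abs_mul, abs_mul (β / 6), abs_div, abs_div]
        norm_num
        exact h
    _ ≤ τ * (2 * A) ^ 3 + |α| / 2 * ((2 * E + D ^ 2) * q * A ^ 3)
        + |β| / 6 * (7 * D * q * A ^ 3) := by gcongr
    _ = _ := by ring

end Cubic

theorem integral_cubic_profile_mul_cos (a α β : ℝ) :
    ∫ t in (0 : ℝ)..2 * Real.pi, (α / 2 * (a * Real.cos t) ^ 2
      + α * (a * Real.cos t) * (a ^ 2 * (α * (Real.cos t ^ 2 / 6 - 1 / 3)))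
      + β / 6 * (a * Real.cos t) ^ 3) * Real.cos t
    = Real.pi * (β - 5 / 3 * α ^ 2) / 8 * a ^ 3 := by
  have e : ∀ t, (α / 2 * (a * Real.cos t) ^ 2
      + α * (a * Real.cos t) * (a ^ 2 * (α * (Real.cos t ^ 2 / 6 - 1 / 3)))
      + β / 6 * (a * Real.cos t) ^ 3) * Real.cos t
      = α / 2 * a ^ 2 * Real.cos t ^ 3 + (α ^ 2 + β) / 6 * a ^ 3 * Real.cos t ^ 4
        - α ^ 2 / 3 * a ^ 3 * Real.cos t ^ 2 := fun t => by ring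
  have I : ∀ {φ : ℝ → ℝ}, Continuous φ →
      IntervalIntegrable φ MeasureTheory.volume 0 (2 * Real.pi) :=
    fun hφ => hφ.intervalIntegrable _ _
  simp only [e]
  rw [intervalIntegral.integral_sub (I (by fun_prop)) (I (by fun_prop)),
    intervalIntegral.integral_add (I (by fun_prop)) (I (by fun_prop)),
    intervalIntegral.integral_const_mul, intervalIntegral.integral_const_mul,
    intervalIntegral.integral_const_mul, integral_cos_sq_two_pi, integral_cos_pow_three_two_pi,
    integral_cos_pow_four_two_pi]
  ring

/-- The second-order correction profile. -/
theorem isEvenPeriodicC2_profile (c : ℝ) :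
    IsEvenPeriodicC2 (fun t => c * (Real.cos t ^ 2 / 6 - 1 / 3)) :=
  ⟨by fun_prop, fun t => by simp only [Real.cos_periodic t], fun t => by simp only [Real.cos_neg]⟩

theorem deriv_deriv_profile (c t : ℝ) :
    deriv (deriv fun t => c * (Real.cos t ^ 2 / 6 - 1 / 3)) t
      = -(c / 3 * (2 * Real.cos t ^ 2 - 1)) := by
  have h1 : (deriv fun t => c * (Real.cos t ^ 2 / 6 - 1 / 3))
      = fun t => -(c / 3 * (Real.cos t * Real.sin t)) := by
    funext t
    have h := ((((Real.hasDerivAt_cos t).pow 2).div_const 6).sub_const (1 / 3)).const_mul c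
    refine HasDerivAt.deriv ?_
    convert! h using 1
    norm_num
    ring
  rw [h1]
  have h := (((Real.hasDerivAt_cos t).mul (Real.hasDerivAt_sin t)).const_mul (c / 3)).neg
  refine HasDerivAt.deriv ?_
  convert! h using 1
  linear_combination -(c / 3) * Real.sin_sq_add_cos_sq t

theorem integral_profile_mul_cos (c : ℝ) :
    ∫ t in (0 : ℝ)..2 * Real.pi, c * (Real.cos t ^ 2 / 6 - 1 / 3) * Real.cos t = 0 := by
  have e : ∀ t, c * (Real.cos t ^ 2 / 6 - 1 / 3) * Real.cos t
      = c / 6 * Real.cos t ^ 3 - c / 3 * Real.cos t := fun t => by ring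
  simp only [e]
  rw [intervalIntegral.integral_sub (Continuous.intervalIntegrable (by fun_prop) _ _)
    (Continuous.intervalIntegrable (by fun_prop) _ _), intervalIntegral.integral_const_mul,
    intervalIntegral.integral_const_mul, integral_cos_pow_three_two_pi]
  simp

set_option maxHeartbeats 1600000 in
theorem eq_zero_of_small_of_hard {φ : ℝ → ℝ} {α β τ ρ Ω K : ℝ} (hΩ : 0 < Ω) (hK : 0 < K)
    (hτ : 0 < τ) (hρ : 0 < ρ)
    (hφ : ∀ x, |x| ≤ ρ → |φ x - α / 2 * x ^ 2 - β / 6 * x ^ 3| ≤ τ * |x| ^ 3)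
    (hb : 0 < β - 5 / 3 * α ^ 2) (hτb : 256 * τ ≤ β - 5 / 3 * α ^ 2) :
    ∃ s > (0 : ℝ), ∀ ω : ℝ, 0 < Ω ^ 2 - ω ^ 2 → Ω ^ 2 - ω ^ 2 ≤ s → NonresonantEstimate Ω ω K →
      ∀ y : ℤ → ℝ → ℝ, (∀ n, IsEvenPeriodicC2 (y n)) →
        (∀ n t, ω ^ 2 * deriv (deriv (y n)) t + Ω ^ 2 * y n t + Ω ^ 2 * φ (y n t) =
          y (n + 1) t - 2 * y n t + y (n - 1) t) →
        (∀ n t, |y n t| ≤ s) →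
        (∀ η > (0 : ℝ), ∃ N : ℕ, ∀ n : ℤ, N ≤ n.natAbs → ∀ t, |y n t| ≤ η) →
        ∀ n t, y n t = 0 := by
  obtain ⟨C2, hC2⟩ : ∃ C, C = |α| / 2 + (|β| / 6 + τ) := ⟨_, rfl⟩
  have hC2p : 0 ≤ C2 := by rw [hC2]; positivity
  obtain ⟨D, hD⟩ : ∃ C, C = K * (Ω ^ 2 * (C2 * 4)) := ⟨_, rfl⟩
  have hDp : 0 ≤ D := by rw [hD]; positivity
  obtain ⟨C5, hC5⟩ : ∃ C, C = 8 * (|β| / 6 + τ) + 3 / 2 * |α| * D := ⟨_, rfl⟩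
  have hC5p : 0 ≤ C5 := by rw [hC5]; positivity
  obtain ⟨C6, hC6⟩ : ∃ C, C = 1 + 2 * Ω ^ 2 * C5 := ⟨_, rfl⟩
  have hC6p : 0 ≤ C6 := by rw [hC6]; positivity
  obtain ⟨C7, hC7⟩ : ∃ C, C = 2 + C6 := ⟨_, rfl⟩
  have hC7p : 0 ≤ C7 := by rw [hC7]; positivity
  obtain ⟨C8, hC8⟩ : ∃ C, C = 2 * C6 + 2 * C7 ^ 2 := ⟨_, rfl⟩
  have hC8p : 0 ≤ C8 := by rw [hC8]; positivity
  obtain ⟨C9, hC9⟩ : ∃ C, C = Ω ^ 2 * C5 + |α| + |α| * C8 := ⟨_, rfl⟩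
  have hC9p : 0 ≤ C9 := by rw [hC9]; positivity
  obtain ⟨C10, hC10⟩ : ∃ C, C = |α| / 2 * (2 * (K * C9) + D ^ 2) + 7 / 6 * |β| * D := ⟨_, rfl⟩
  have hC10p : 0 ≤ C10 := by rw [hC10]; positivity
  obtain ⟨b, hbdef⟩ : ∃ b, b = β - 5 / 3 * α ^ 2 := ⟨_, rfl⟩
  rw [← hbdef] at hb hτb
  obtain ⟨m, hm⟩ := exists_nat_gt (64 * C10 / b)
  have hm0 : (0 : ℝ) < m := lt_of_le_of_lt (by positivity) hm
  have hmpos : 0 < m := by exact_mod_cast hm0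
  obtain ⟨q, hq⟩ : ∃ q : ℝ, q = 1 / m := ⟨_, rfl⟩
  have hq0 : 0 < q := by rw [hq]; positivity
  have hq1 : q ≤ 1 := by
    rw [hq, div_le_one hm0]
    exact_mod_cast hmpos
  have hmq : (m : ℝ) * q = 1 := by rw [hq]; field_simp
  have hqb : 64 * C10 * q < b := by
    rw [div_lt_iff₀ hb] at hm
    calc 64 * C10 * q < m * b * q := by gcongr
      _ = m * q * b := by ring
      _ = b := by rw [hmq, one_mul]
  refine ⟨min (min ρ (q ^ 2 / 2)) (1 / (2 * (K * (Ω ^ 2 * C2) + 1))),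
    lt_min (lt_min hρ (by positivity)) (by positivity), ?_⟩
  set s := min (min ρ (q ^ 2 / 2)) (1 / (2 * (K * (Ω ^ 2 * C2) + 1))) with hs
  have hsρ : s ≤ ρ := (min_le_left _ _).trans (min_le_left _ _)
  have hsq : s ≤ q ^ 2 / 2 := (min_le_left _ _).trans (min_le_right _ _)
  have hsK : K * (Ω ^ 2 * C2) * s ≤ 1 / 2 := by
    have h1 : s ≤ 1 / (2 * (K * (Ω ^ 2 * C2) + 1)) := min_le_right _ _
    have h2 : 0 ≤ K * (Ω ^ 2 * C2) := by positivity
    rw [le_div_iff₀ (by positivity)] at h1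
    have h3 : 0 < s := lt_min (lt_min hρ (by positivity)) (by positivity)
    nlinarith
  have hq2 : q ^ 2 ≤ q := by nlinarith
  have hs1 : s ≤ 1 := by linarith
  clear_value s
  intro ω hμ0 hμs hKω y hy heq hsmall hdecay
  obtain ⟨μ, hμ⟩ : ∃ μ, μ = Ω ^ 2 - ω ^ 2 := ⟨_, rfl⟩
  rw [← hμ] at hμ0 hμs
  have hμq : μ ≤ q ^ 2 := by nlinarith
  have I : ∀ {φ : ℝ → ℝ}, Continuous φ →
      IntervalIntegrable φ MeasureTheory.volume 0 (2 * Real.pi) :=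
    fun hφ => hφ.intervalIntegrable _ _
  have hpi := Real.pi_pos
  -- first harmonic
  obtain ⟨a, ha⟩ : ∃ a : ℤ → ℝ, ∀ n,
      a n = 1 / Real.pi * ∫ t in (0 : ℝ)..2 * Real.pi, y n t * Real.cos t := ⟨_, fun _ => rfl⟩
  have ha_le : ∀ n (B : ℝ), (∀ t, |y n t| ≤ B) → |a n| ≤ 2 * B := by
    intro n B hB
    have h := abs_integral_mul_cos_le hB 1
    simp only [one_mul] at h
    rw [ha, abs_mul, abs_of_pos (by positivity), one_div, inv_mul_le_iff₀ hpi]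
    linarith
  obtain ⟨n₀, hn₀⟩ : ∃ n₀, ∀ n, |a n| ≤ |a n₀| := by
    refine exists_forall_abs_le_of_decay fun η hη => ?_
    obtain ⟨N, hN⟩ := hdecay (η / 2) (by positivity)
    exact ⟨N, fun n hn => by linarith [ha_le n _ (hN n hn)]⟩
  obtain ⟨A, hA⟩ : ∃ A, A = |a n₀| := ⟨_, rfl⟩
  rw [← hA] at hn₀
  have hA0 : 0 ≤ A := by rw [hA]; positivity
  have hAq2 : A ≤ q ^ 2 := by
    have := ha_le n₀ s (hsmall n₀)
    linarith
  have hAq : A ≤ q := hAq2.trans hq2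
  have hA1 : A ≤ 1 := hAq.trans hq1
  have hu : ∀ n t, |a n * Real.cos t| ≤ A := fun n t => by
    rw [abs_mul]
    exact (mul_le_of_le_one_right (abs_nonneg _) (Real.abs_cos_le_one t)).trans (hn₀ n)
  -- the complement of the first harmonic
  obtain ⟨z, hz⟩ : ∃ z : ℤ → ℝ → ℝ, ∀ n, z n = fun t => y n t - a n * Real.cos t :=
    ⟨_, fun _ => rfl⟩
  have hzt : ∀ n t, z n t = y n t - a n * Real.cos t := fun n t => by rw [hz]
  have hcos := isEvenPeriodicC2_cos
  have hzP : ∀ n, IsEvenPeriodicC2 (z n) := fun n => by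
    rw [hz]
    exact (hy n).sub (hcos.const_mul _)
  have hzdd : ∀ n t, deriv (deriv (z n)) t = deriv (deriv (y n)) t + a n * Real.cos t := by
    intro n t
    rw [hz, (hy n).deriv_deriv_sub (hcos.const_mul _), hcos.deriv_deriv_const_mul]
    simp
  have hz1 : ∀ n, ∫ t in (0 : ℝ)..2 * Real.pi, z n t * Real.cos t = 0 := by
    intro n
    have hc := (hy n).continuous
    have e : ∀ t, z n t * Real.cos t = y n t * Real.cos t - a n * Real.cos t ^ 2 :=
      fun t => by rw [hzt]; ring
    simp only [e]
    rw [intervalIntegral.integral_sub (I (by fun_prop)) (I (by fun_prop)),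
      intervalIntegral.integral_const_mul, integral_cos_sq_two_pi, ha]
    field_simp
    ring
  have hzeq : ∀ n t, ω ^ 2 * deriv (deriv (z n)) t + Ω ^ 2 * z n t + Ω ^ 2 * φ (y n t) =
      z (n + 1) t - 2 * z n t + z (n - 1) t
        + (a (n + 1) - 2 * a n + a (n - 1) - μ * a n) * Real.cos t := by
    intro n t
    rw [hzdd, hzt, hzt, hzt, hμ]
    linear_combination heq n t
  have hz_quad : ∀ S, S ≤ s → (∀ n t, |y n t| ≤ S) →
      ∀ n t, |z n t| ≤ K * (Ω ^ 2 * (C2 * S ^ 2)) := by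
    intro S hSs hS
    refine hKω z (fun n t => Ω ^ 2 * φ (y n t))
      (fun n => a (n + 1) - 2 * a n + a (n - 1) - μ * a n) (s + A) _ hzP hz1 ?_ ?_ hzeq
    · intro n t
      rw [hzt]
      exact (abs_sub _ _).trans (add_le_add (hsmall n t) (hu n t))
    · intro n t
      rw [abs_mul, abs_of_pos (by positivity : 0 < Ω ^ 2), hC2]
      exact mul_le_mul_of_nonneg_left (abs_le_of_cubic_expansion
        (hφ _ ((hsmall n t).trans hsρ)) hτ.le (hS n t) (hSs.trans hs1)) (by positivity)
  have hyA : ∀ n t, |y n t| ≤ 2 * A := by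
    intro n t
    have h := abs_le_of_forall_bound_improves (x := fun p : ℤ × ℝ => y p.1 p.2) (B := s) (c := A)
      (θ := 1 / 2) (fun p => hsmall p.1 p.2) (by norm_num) (by
        intro S hS0 hSs hS p
        have h1 := hz_quad S hSs (fun n t => hS (n, t)) p.1 p.2
        have h2 : y p.1 p.2 = a p.1 * Real.cos p.2 + z p.1 p.2 := by rw [hzt]; ring
        have h3 : K * (Ω ^ 2 * (C2 * S ^ 2)) ≤ 1 / 2 * S := by
          have : K * (Ω ^ 2 * C2) * S ≤ 1 / 2 :=
            (mul_le_mul_of_nonneg_left hSs (by positivity)).trans hsK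
          calc K * (Ω ^ 2 * (C2 * S ^ 2)) = K * (Ω ^ 2 * C2) * S * S := by ring
            _ ≤ 1 / 2 * S := mul_le_mul_of_nonneg_right this hS0
        rw [h2]
        exact (abs_add_le _ _).trans (add_le_add (hu _ _) (h1.trans h3))) (n, t)
    refine h.trans (le_of_eq ?_)
    ring
  rcases hA0.eq_or_lt with hA00 | hApos
  · intro n t
    have := hyA n t
    rw [← hA00, mul_zero] at this
    exact abs_nonpos_iff.1 this
  exfalso
  have hzA : ∀ n t, |z n t| ≤ D * A ^ 2 := by
    obtain ⟨S, hS⟩ : ∃ S, S = min s (2 * A) := ⟨_, rfl⟩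
    intro n t
    have hS0 : 0 ≤ S := by
      rw [hS]; exact le_min ((abs_nonneg _).trans (hsmall 0 0)) (by linarith)
    have hS2 : S ≤ 2 * A := by rw [hS]; exact min_le_right _ _
    have h1 := hz_quad S (by rw [hS]; exact min_le_left _ _)
      (fun n t => by rw [hS]; exact le_min (hsmall n t) (hyA n t)) n t
    calc |z n t| ≤ K * (Ω ^ 2 * (C2 * S ^ 2)) := h1
      _ ≤ K * (Ω ^ 2 * (C2 * (2 * A) ^ 2)) := by gcongr
      _ = D * A ^ 2 := by rw [hD]; ring
  have hyuz : ∀ n t, y n t = a n * Real.cos t + z n t := fun n t => by rw [hzt]; ring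
  have hφy : ∀ n t, |φ (y n t) - α / 2 * y n t ^ 2 - β / 6 * y n t ^ 3| ≤ τ * |y n t| ^ 3 :=
    fun n t => hφ _ ((hsmall n t).trans hsρ)
  have hE : ∀ n t, |φ (y n t) - α / 2 * (a n * Real.cos t) ^ 2| ≤ C5 * A ^ 3 := by
    intro n t
    rw [hC5]
    exact abs_sub_quadratic_le_of_cubic_expansion (hφy n t) hτ.le (hyuz n t) (hyA n t) (hu n t)
      (hzA n t)
  have hcφ : ∀ n, Continuous (fun t => φ (y n t)) := fun n =>
    (integral_mul_cos_eq hΩ hy (heq n)).1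
  have hΔ : ∀ n, a (n + 1) - 2 * a n + a (n - 1) = μ * a n
      + Ω ^ 2 / Real.pi * ∫ t in (0 : ℝ)..2 * Real.pi, φ (y n t) * Real.cos t := by
    intro n
    have h := (integral_mul_cos_eq hΩ hy (heq n)).2
    rw [← hμ] at h
    rw [ha, ha, ha]
    linear_combination 1 / Real.pi * h
  have hΔ_le : ∀ n, |a (n + 1) - 2 * a n + a (n - 1)| ≤ C6 * q ^ 2 * A := by
    intro n
    have hc := hcφ n
    have h1 : ∫ t in (0 : ℝ)..2 * Real.pi, φ (y n t) * Real.cos t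
        = ∫ t in (0 : ℝ)..2 * Real.pi,
          (φ (y n t) - α / 2 * (a n * Real.cos t) ^ 2) * Real.cos t := by
      have e : ∀ t, (φ (y n t) - α / 2 * (a n * Real.cos t) ^ 2) * Real.cos t
          = φ (y n t) * Real.cos t - α / 2 * a n ^ 2 * Real.cos t ^ 3 := fun t => by ring
      simp only [e]
      have hccos : Continuous (fun t => φ (y n t) * Real.cos t) := hc.mul Real.continuous_cos
      rw [intervalIntegral.integral_sub (I hccos) (I (by fun_prop)),
        intervalIntegral.integral_const_mul, integral_cos_pow_three_two_pi]
      ring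
    have h2 := abs_integral_mul_cos_le (hE n) 1
    simp only [one_mul] at h2
    rw [hΔ n, h1]
    set J := ∫ t in (0 : ℝ)..2 * Real.pi,
      (φ (y n t) - α / 2 * (a n * Real.cos t) ^ 2) * Real.cos t
    have h3 : A ^ 3 ≤ q ^ 2 * A := by
      have : A ^ 2 ≤ q ^ 2 := by gcongr
      nlinarith
    calc |μ * a n + Ω ^ 2 / Real.pi * J| ≤ |μ * a n| + |Ω ^ 2 / Real.pi * J| := abs_add_le _ _
      _ ≤ μ * A + Ω ^ 2 / Real.pi * (2 * Real.pi * (C5 * A ^ 3)) := by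
        rw [abs_mul, abs_mul, abs_of_pos hμ0, abs_of_pos (by positivity : 0 < Ω ^ 2 / Real.pi)]
        gcongr
        exact hn₀ n
      _ = μ * A + 2 * Ω ^ 2 * C5 * A ^ 3 := by field_simp
      _ ≤ q ^ 2 * A + 2 * Ω ^ 2 * C5 * (q ^ 2 * A) := by gcongr
      _ = C6 * q ^ 2 * A := by rw [hC6]; ring
  have hd : ∀ n, |a (n + 1) - a n| ≤ C7 * q * A := by
    intro n
    refine (abs_sub_le_of_abs_second_difference_le hn₀ hΔ_le hmpos n).trans (le_of_eq ?_)
    rw [hC7, hq]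
    field_simp
  have hΔsq : ∀ n, |a (n + 1) ^ 2 - 2 * a n ^ 2 + a (n - 1) ^ 2| ≤ C8 * q * A ^ 2 := by
    intro n
    have e : a (n + 1) ^ 2 - 2 * a n ^ 2 + a (n - 1) ^ 2
        = 2 * (a n * (a (n + 1) - 2 * a n + a (n - 1))) + (a (n + 1) - a n) ^ 2
          + (a (n - 1 + 1) - a (n - 1)) ^ 2 := by
      rw [sub_add_cancel]; ring
    have h1 : |a n| * |a (n + 1) - 2 * a n + a (n - 1)| ≤ A * (C6 * q ^ 2 * A) :=
      mul_le_mul (hn₀ n) (hΔ_le n) (abs_nonneg _) hA0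
    have h2 : |a (n + 1) - a n| ^ 2 ≤ (C7 * q * A) ^ 2 := by
      gcongr; exact hd n
    have h3 : |a (n - 1 + 1) - a (n - 1)| ^ 2 ≤ (C7 * q * A) ^ 2 := by
      gcongr; exact hd (n - 1)
    rw [e]
    refine (abs_add_three _ _ _).trans ?_
    rw [abs_mul, abs_mul, abs_pow, abs_pow, abs_of_pos (by norm_num : (0 : ℝ) < 2)]
    calc _ ≤ 2 * (A * (C6 * q ^ 2 * A)) + (C7 * q * A) ^ 2 + (C7 * q * A) ^ 2 := by gcongr
      _ = C8 * A ^ 2 * q ^ 2 := by rw [hC8]; ring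
      _ ≤ C8 * A ^ 2 * q := by gcongr
      _ = _ := by ring
  -- second-order correction
  obtain ⟨r, hr⟩ : ∃ r : ℤ → ℝ → ℝ, ∀ n,
      r n = fun t => z n t - a n ^ 2 * (α * (Real.cos t ^ 2 / 6 - 1 / 3)) := ⟨_, fun _ => rfl⟩
  have hrt : ∀ n t, r n t = z n t - a n ^ 2 * (α * (Real.cos t ^ 2 / 6 - 1 / 3)) :=
    fun n t => by rw [hr]
  have hp := isEvenPeriodicC2_profile α
  have hcos2 : ∀ t, 0 ≤ Real.cos t ^ 2 ∧ Real.cos t ^ 2 ≤ 1 := fun t =>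
    ⟨sq_nonneg _, Real.cos_sq_le_one t⟩
  have hp_le : ∀ t, |α * (Real.cos t ^ 2 / 6 - 1 / 3)| ≤ |α| := fun t => by
    rw [abs_mul]
    refine mul_le_of_le_one_right (abs_nonneg _) ?_
    exact abs_le.2 ⟨by linarith [hcos2 t], by linarith [hcos2 t]⟩
  have hp2_le : ∀ t, |α / 3 * (2 * Real.cos t ^ 2 - 1)| ≤ |α| := fun t => by
    rw [div_mul_eq_mul_div, mul_div_assoc, abs_mul]
    refine mul_le_of_le_one_right (abs_nonneg _) ?_
    exact abs_le.2 ⟨by linarith [hcos2 t], by linarith [hcos2 t]⟩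
  have ha2 : ∀ n, a n ^ 2 ≤ A ^ 2 := fun n => by
    rw [← sq_abs]
    gcongr
    exact hn₀ n
  have hr_le : ∀ n t, |r n t| ≤ K * (C9 * q * A ^ 2) := by
    refine hKω r (fun n t => Ω ^ 2 * (φ (y n t) - α / 2 * (a n * Real.cos t) ^ 2)
        + μ * (a n ^ 2 * (α / 3 * (2 * Real.cos t ^ 2 - 1)))
        - (a (n + 1) ^ 2 - 2 * a n ^ 2 + a (n - 1) ^ 2) * (α * (Real.cos t ^ 2 / 6 - 1 / 3)))
      (fun n => a (n + 1) - 2 * a n + a (n - 1) - μ * a n) (D * A ^ 2 + A ^ 2 * |α|) _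
      ?_ ?_ ?_ ?_ ?_
    · intro n
      rw [hr]
      exact (hzP n).sub (hp.const_mul _)
    · intro n
      have hc := (hzP n).continuous
      have e : ∀ t, r n t * Real.cos t = z n t * Real.cos t
          - a n ^ 2 * (α * (Real.cos t ^ 2 / 6 - 1 / 3) * Real.cos t) := fun t => by
        rw [hrt]; ring
      simp only [e]
      rw [intervalIntegral.integral_sub (I (by fun_prop)) (I (by fun_prop)), hz1,
        intervalIntegral.integral_const_mul, integral_profile_mul_cos]
      ring
    · intro n t
      rw [hrt]
      refine (abs_sub _ _).trans (add_le_add (hzA n t) ?_)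
      rw [abs_mul, abs_of_nonneg (sq_nonneg (a n))]
      exact mul_le_mul (ha2 n) (hp_le t) (abs_nonneg _) (by positivity)
    · intro n t
      have h1 : A ^ 3 ≤ q * A ^ 2 := by nlinarith [sq_nonneg A]
      have h2 : μ ≤ q := hμq.trans hq2
      calc _ ≤ |Ω ^ 2 * (φ (y n t) - α / 2 * (a n * Real.cos t) ^ 2)|
            + |μ * (a n ^ 2 * (α / 3 * (2 * Real.cos t ^ 2 - 1)))|
            + |(a (n + 1) ^ 2 - 2 * a n ^ 2 + a (n - 1) ^ 2)
              * (α * (Real.cos t ^ 2 / 6 - 1 / 3))| :=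
          (abs_sub _ _).trans (add_le_add_left (abs_add_le _ _) _)
        _ ≤ Ω ^ 2 * (C5 * A ^ 3) + μ * (A ^ 2 * |α|) + C8 * q * A ^ 2 * |α| := by
          rw [abs_mul, abs_mul μ, abs_mul (a n ^ 2), abs_mul (a (n + 1) ^ 2 - _ + _),
            abs_of_pos (by positivity : 0 < Ω ^ 2), abs_of_pos hμ0,
            abs_of_nonneg (sq_nonneg (a n))]
          have e1 := mul_le_mul (ha2 n) (hp2_le t) (abs_nonneg _) (by positivity)
          have e2 := mul_le_mul (hΔsq n) (hp_le t) (abs_nonneg _) (by positivity)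
          have e3 := hE n t
          gcongr
        _ ≤ Ω ^ 2 * (C5 * (q * A ^ 2)) + q * (A ^ 2 * |α|) + C8 * q * A ^ 2 * |α| := by gcongr
        _ = _ := by rw [hC9]; ring
    · intro n t
      rw [hr, (hzP n).deriv_deriv_sub (hp.const_mul _), hp.deriv_deriv_const_mul,
        deriv_deriv_profile, hrt, hrt]
      linear_combination hzeq n t + (Real.cos t ^ 2 * 2 - 1) * α / 3 * a n ^ 2 * hμ
  -- evaluate the projected equation at a maximum of `|a n|`
  have hE2 : ∀ t, |φ (y n₀ t) - (α / 2 * (a n₀ * Real.cos t) ^ 2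
      + α * (a n₀ * Real.cos t) * (a n₀ ^ 2 * (α * (Real.cos t ^ 2 / 6 - 1 / 3)))
      + β / 6 * (a n₀ * Real.cos t) ^ 3)| ≤ (8 * τ + C10 * q) * A ^ 3 := by
    intro t
    rw [hC10]
    exact abs_sub_cubic_le_of_cubic_expansion (hφy n₀ t) hτ.le (hyuz n₀ t)
      (by rw [hrt]; ring) (hyA n₀ t) (hu n₀ t) hDp (hzA n₀ t)
      ((hr_le n₀ t).trans (le_of_eq (by ring))) hAq
  have hcφ₀ := hcφ n₀
  have h1 := abs_integral_mul_cos_le hE2 1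
  simp only [one_mul, sub_mul] at h1
  have hcφ₀cos : Continuous (fun t => φ (y n₀ t) * Real.cos t) := hcφ₀.mul Real.continuous_cos
  rw [intervalIntegral.integral_sub (I hcφ₀cos) (I (by fun_prop)),
    integral_cubic_profile_mul_cos, ← hbdef] at h1
  obtain ⟨J, hJ⟩ : ∃ J, J = ∫ t in (0 : ℝ)..2 * Real.pi, φ (y n₀ t) * Real.cos t := ⟨_, rfl⟩
  have hΔ₀ := hΔ n₀
  rw [← hJ] at h1 hΔ₀
  have hmax : a n₀ * (a (n₀ + 1) - 2 * a n₀ + a (n₀ - 1)) ≤ 0 := by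
    have e1 : a n₀ * a (n₀ + 1) ≤ A * A := (le_abs_self _).trans (by
      rw [abs_mul]; exact mul_le_mul (hn₀ _) (hn₀ _) (abs_nonneg _) hA0)
    have e2 : a n₀ * a (n₀ - 1) ≤ A * A := (le_abs_self _).trans (by
      rw [abs_mul]; exact mul_le_mul (hn₀ _) (hn₀ _) (abs_nonneg _) hA0)
    have e3 : a n₀ * a n₀ = A * A := by rw [hA, abs_mul_abs_self]
    linarith
  rw [hΔ₀] at hmax
  have ha₀2 : a n₀ ^ 2 = A ^ 2 := by rw [hA, sq_abs]
  have haJ : 0 < a n₀ * J := by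
    have e1 : |a n₀ * (J - Real.pi * b / 8 * a n₀ ^ 3)|
        ≤ A * (2 * Real.pi * ((8 * τ + C10 * q) * A ^ 3)) := by
      rw [abs_mul, ← hA]
      exact mul_le_mul_of_nonneg_left h1 hA0
    have e2 := (abs_le.1 e1).1
    have e3 : a n₀ * (J - Real.pi * b / 8 * a n₀ ^ 3)
        = a n₀ * J - Real.pi * b / 8 * A ^ 4 := by
      linear_combination -(Real.pi * b / 8) * (a n₀ ^ 2 + A ^ 2) * ha₀2
    have e4 : 0 < Real.pi * A ^ 4 * (b / 8 - 2 * (8 * τ + C10 * q)) :=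
      mul_pos (by positivity) (by linarith)
    rw [e3] at e2
    linarith
  have e5 : a n₀ * (μ * a n₀ + Ω ^ 2 / Real.pi * J)
      = μ * A ^ 2 + Ω ^ 2 / Real.pi * (a n₀ * J) := by
    rw [← ha₀2]; ring
  have e6 : 0 < μ * A ^ 2 + Ω ^ 2 / Real.pi * (a n₀ * J) := by positivity
  linarith


/-- Nonexistence of small-amplitude discrete breathers with frequencies just below
the lower phonon band edge Ω for the rescaled homogeneous Klein-Gordon lattice with
hard on-site potential (b > 0) and Ω > 2/√3. -/
theorem stmt_19 (V : ℝ → ℝ) (hV : ∃ r > (0 : ℝ), ContDiffOn ℝ 6 V (Metric.ball 0 r))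
    (hV1 : deriv V 0 = 0) (hV2 : iteratedDeriv 2 V 0 = 1)
    (Ω : ℝ) (hΩ : 2 / Real.sqrt 3 < Ω)
    (hb : 0 < iteratedDeriv 4 V 0 - 5 / 3 * (iteratedDeriv 3 V 0) ^ 2) :
    ∃ δ > (0 : ℝ), ∃ ε > (0 : ℝ), ∀ ω : ℝ, Ω - δ < ω → ω < Ω →
      ∀ y : ℤ → ℝ → ℝ,
        (∀ n : ℤ, ContDiff ℝ 2 (y n)) →
        (∀ n : ℤ, Function.Periodic (y n) (2 * Real.pi)) →
        (∀ n : ℤ, ∀ t : ℝ, y n (-t) = y n t) →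
        (∀ n : ℤ, ∀ t : ℝ,
          ω ^ 2 * deriv (deriv (y n)) t + Ω ^ 2 * deriv V (y n t) =
            y (n + 1) t - 2 * y n t + y (n - 1) t) →
        (∀ n : ℤ, ∀ t : ℝ, |y n t| + |deriv (deriv (y n)) t| ≤ ε) →
        (∀ η > (0 : ℝ), ∃ N : ℕ, ∀ n : ℤ, N ≤ n.natAbs → ∀ t : ℝ,
          |y n t| + |deriv (deriv (y n)) t| ≤ η) →
        ∀ n : ℤ, ∀ t : ℝ, y n t = 0 := by
  obtain ⟨r, hr, hVr⟩ := hV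
  have hs3 : 0 < Real.sqrt 3 := by positivity
  have hΩ0 : 0 < Ω := lt_trans (by positivity) hΩ
  have hΩ2 : 4 < 3 * Ω ^ 2 := by
    rw [div_lt_iff₀ hs3] at hΩ
    have h1 : (2 : ℝ) ^ 2 < (Ω * Real.sqrt 3) ^ 2 := by gcongr
    rw [mul_pow, Real.sq_sqrt (by norm_num)] at h1
    linarith
  obtain ⟨m, hm⟩ : ∃ m, m = (3 * Ω ^ 2 - 4) / 2 := ⟨_, rfl⟩
  have hm0 : 0 < m := by rw [hm]; linarith
  obtain ⟨K, hK, hKω⟩ := exists_nonresonantEstimate hΩ0 hm0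
  obtain ⟨ρ, hρ, hφ⟩ := deriv_taylor_three hr hVr hV1 hV2
    (τ := (iteratedDeriv 4 V 0 - 5 / 3 * (iteratedDeriv 3 V 0) ^ 2) / 256) (by positivity)
  obtain ⟨s, hs, hzero⟩ := eq_zero_of_small_of_hard (φ := fun x => deriv V x - x) hΩ0 hK
    (by positivity) hρ hφ hb (by linarith)
  refine ⟨min Ω (min (s / (2 * Ω)) (m / (8 * Ω))), by positivity, s, hs, ?_⟩
  intro ω hω1 hω2 y hy hper heven heq hsmall hdecay
  have h1 : Ω - ω < Ω := by linarith [min_le_left Ω (min (s / (2 * Ω)) (m / (8 * Ω)))]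
  have h2 : Ω - ω < s / (2 * Ω) := by
    linarith [(min_le_right Ω (min (s / (2 * Ω)) (m / (8 * Ω)))).trans (min_le_left _ _)]
  have h3 : Ω - ω < m / (8 * Ω) := by
    linarith [(min_le_right Ω (min (s / (2 * Ω)) (m / (8 * Ω)))).trans (min_le_right _ _)]
  have hω0 : 0 < ω := by linarith
  rw [lt_div_iff₀ (by positivity)] at h2 h3
  have hμ : Ω ^ 2 - ω ^ 2 ≤ (Ω - ω) * (2 * Ω) := by nlinarith [sq_nonneg (Ω - ω)]
  refine hzero ω (by nlinarith) (by linarith) (hKω ω (by linarith)) y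
    (fun n => ⟨hy n, hper n, heven n⟩) (fun n t => ?_)
    (fun n t => (le_add_of_nonneg_right (abs_nonneg _)).trans (hsmall n t)) ?_
  · rw [← heq n t]
    ring
  · intro η hη
    obtain ⟨N, hN⟩ := hdecay η hη
    exact ⟨N, fun n hn t => (le_add_of_nonneg_right (abs_nonneg _)).trans (hN n hn t)⟩
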